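/- If f : ℝ → ℝ is bounded continuous and 0 < h ≤ δ, then for every r ≥ 1, (1 + 2^{-r} r^r) ‖(I - T_h)^r f‖ ≤ 2^{2r}(r^r + 34^r) · 2^r ‖(I - T_δ)^r f‖ in the sup norm; in particular δ ↦ ‖(I - T_δ)^r f‖ is monotone up to a constant depending only on r. -/

import Mathlib

/-- Forward Steklov operator `T_δ f(x) = (1/δ) ∫₀^δ f(x+t) dt`. -/
noncomputable def steklov (δ : ℝ) (f : ℝ → ℝ) : ℝ → ℝ :=
  fun x => (1 / δ) * ∫ t in (0:ℝ)..δ, f (x + t)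

/-- The difference operator `(I - T_δ) f`. -/
noncomputable def steklovDiff (δ : ℝ) (f : ℝ → ℝ) : ℝ → ℝ :=
  fun x => f x - steklov δ f x

section SteklovAverage

variable {f g : ℝ → ℝ} {δ M : ℝ}

lemma steklov_continuous (hf : Continuous f) : Continuous (steklov δ f) := by
  unfold steklov
  exact continuous_const.mul
    (intervalIntegral.continuous_parametric_intervalIntegral_of_continuous' (by fun_prop) _ _)

lemma steklovDiff_continuous (hf : Continuous f) : Continuous (steklovDiff δ f) :=
  hf.sub (steklov_continuous hf)

lemma abs_steklov_le (hδ : 0 < δ) (hM : ∀ x, |f x| ≤ M) (x : ℝ) : |steklov δ f x| ≤ M := by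
  have h := intervalIntegral.norm_integral_le_of_norm_le_const (a := 0) (b := δ)
    (f := fun t => f (x + t)) (C := M) (fun t _ => hM (x + t))
  rw [Real.norm_eq_abs, sub_zero, abs_of_pos hδ] at h
  rw [steklov, abs_mul, abs_of_pos (one_div_pos.2 hδ), one_div_mul_eq_div, div_le_iff₀ hδ]
  exact h

lemma abs_steklovDiff_le (hδ : 0 < δ) (hM : ∀ x, |f x| ≤ M) (x : ℝ) :
    |steklovDiff δ f x| ≤ 2 * M := by
  have h := abs_sub (f x) (steklov δ f x)
  have := hM x
  have := abs_steklov_le hδ hM x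
  unfold steklovDiff
  linarith

lemma steklov_sub (hf : Continuous f) (hg : Continuous g) :
    steklov δ (fun x => f x - g x) = fun x => steklov δ f x - steklov δ g x := by
  funext x
  simp only [steklov]
  rw [intervalIntegral.integral_sub, mul_sub]
  · exact (by fun_prop : Continuous fun t => f (x + t)).intervalIntegrable _ _
  · exact (by fun_prop : Continuous fun t => g (x + t)).intervalIntegrable _ _

lemma steklov_comm (hf : Continuous f) (h δ : ℝ) :
    steklov h (steklov δ f) = steklov δ (steklov h f) := by
  funext x
  simp only [steklov, intervalIntegral.integral_const_mul]
  rw [MeasureTheory.intervalIntegral_intervalIntegral_swap]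
  · simp only [add_right_comm x]
    ring
  · have hF : Continuous (Function.uncurry fun t s => f (x + t + s)) := by
      simp only [Function.uncurry_def]
      fun_prop
    exact (hF.continuousOn.integrableOn_compact (isCompact_uIcc.prod isCompact_uIcc)).mono_set
      (Set.prod_mono Set.uIoc_subset_uIcc Set.uIoc_subset_uIcc)

lemma steklovDiff_comm (hf : Continuous f) (h δ : ℝ) :
    steklovDiff h (steklovDiff δ f) = steklovDiff δ (steklovDiff h f) := by
  have h₁ : ∀ a b x, steklov a (steklovDiff b f) x = steklov a f x - steklov a (steklov b f) x :=
    fun a b => congrFun (steklov_sub hf (steklov_continuous hf))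
  funext x
  rw [steklovDiff, h₁, steklovDiff, steklovDiff, h₁, steklovDiff, steklov_comm hf h δ]
  ring

lemma hasDerivAt_steklov (hf : Continuous f) (x : ℝ) :
    HasDerivAt (steklov δ f) ((f (x + δ) - f x) / δ) x := by
  have h₀ : ∀ y, HasDerivAt (fun u => ∫ t in (0:ℝ)..u, f t) (f y) y := fun y =>
    intervalIntegral.integral_hasDerivAt_right (hf.intervalIntegrable _ _)
      (hf.stronglyMeasurableAtFilter _ _) hf.continuousAt
  have h₁ := (((h₀ (x + δ)).comp_add_const x δ).sub (h₀ x)).const_mul (1 / δ)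
  rw [one_div_mul_eq_div] at h₁
  refine h₁.congr_of_eventuallyEq (Filter.Eventually.of_forall fun y => ?_)
  simp only [steklov, intervalIntegral.integral_comp_add_left, add_zero, Pi.sub_apply]
  rw [intervalIntegral.integral_interval_sub_left (hf.intervalIntegrable _ _)
    (hf.intervalIntegrable _ _)]

lemma abs_integral_le_of_abs_le_pow {φ : ℝ → ℝ} {C t : ℝ} (n : ℕ) (ht : 0 ≤ t)
    (hφ : ∀ s, 0 ≤ s → |φ s| ≤ C * s ^ n) :
    |∫ s in (0:ℝ)..t, φ s| ≤ C * t ^ (n + 1) / (n + 1) := by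
  have h := intervalIntegral.norm_integral_le_of_norm_le (μ := MeasureTheory.volume)
    (f := φ) (g := fun s => C * s ^ n) ht (Filter.Eventually.of_forall fun s hs => hφ s hs.1.le)
    ((by fun_prop : Continuous fun s : ℝ => C * s ^ n).intervalIntegrable _ _)
  rw [intervalIntegral.integral_const_mul, integral_pow] at h
  simpa [mul_div_assoc] using h

lemma steklov_sub_self (hδ : 0 < δ) (hf : Continuous f) (x : ℝ) :
    steklov δ f x - f x = (1 / δ) * ∫ t in (0:ℝ)..δ, (f (x + t) - f x) := by
  rw [intervalIntegral.integral_sub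
    ((by fun_prop : Continuous fun t => f (x + t)).intervalIntegrable _ _)
    (continuous_const.intervalIntegrable _ _), intervalIntegral.integral_const, steklov]
  simp only [sub_zero, smul_eq_mul]
  field_simp

/-- A function with derivative bounded by `M` is `(δ / 2) * M`-close to its average. -/
lemma abs_steklovDiff_le_of_hasDerivAt {f' : ℝ → ℝ} (hδ : 0 < δ)
    (hf : ∀ x, HasDerivAt f (f' x) x) (hM : ∀ x, |f' x| ≤ M) (x : ℝ) :
    |steklovDiff δ f x| ≤ δ / 2 * M := by
  have hc : Continuous f := continuous_iff_continuousAt.2 fun x => (hf x).continuousAt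
  have h₁ := abs_integral_le_of_abs_le_pow (φ := fun t => f (x + t) - f x) (C := M) 1 hδ.le
    fun s hs => by
      have := convex_univ.norm_image_sub_le_of_norm_hasDerivWithin_le
        (fun y _ => (hf y).hasDerivWithinAt) (fun y _ => hM y) (Set.mem_univ x)
        (Set.mem_univ (x + s))
      simpa [abs_of_nonneg hs] using this
  rw [steklovDiff, abs_sub_comm, steklov_sub_self hδ hc, abs_mul, abs_of_pos (one_div_pos.2 hδ),
    one_div_mul_eq_div, div_le_iff₀ hδ]
  refine h₁.trans (le_of_eq ?_)
  push_cast
  ring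

/-- Second order Taylor estimate for the Steklov average. -/
lemma abs_deriv_le_of_steklovDiff {f' f'' : ℝ → ℝ} {ε Y : ℝ} (hδ : 0 < δ)
    (hf : ∀ x, HasDerivAt f (f' x) x) (hf' : ∀ x, HasDerivAt f' (f'' x) x)
    (hε : ∀ x, |steklovDiff δ f x| ≤ ε) (hY : ∀ x, |f'' x| ≤ Y) (x : ℝ) :
    δ / 2 * |f' x| ≤ ε + δ ^ 2 / 6 * Y := by
  have hc : Continuous f := continuous_iff_continuousAt.2 fun x => (hf x).continuousAt
  have hc' : Continuous f' := continuous_iff_continuousAt.2 fun x => (hf' x).continuousAt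
  have hTaylor : ∀ s, 0 ≤ s → |f (x + s) - f x - s * f' x| ≤ Y / 2 * s ^ 2 := fun s hs => by
    have h₁ := abs_integral_le_of_abs_le_pow (φ := fun t => f' (x + t) - f' x) (C := Y) 1 hs
      fun t ht => by
        have := convex_univ.norm_image_sub_le_of_norm_hasDerivWithin_le
          (fun y _ => (hf' y).hasDerivWithinAt) (fun y _ => hY y) (Set.mem_univ x)
          (Set.mem_univ (x + t))
        simpa [abs_of_nonneg ht] using this
    have h₂ : ∫ t in (0:ℝ)..s, (f' (x + t) - f' x) = f (x + s) - f x - s * f' x := by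
      rw [intervalIntegral.integral_sub
        ((by fun_prop : Continuous fun t => f' (x + t)).intervalIntegrable _ _)
        (continuous_const.intervalIntegrable _ _), intervalIntegral.integral_const,
        intervalIntegral.integral_comp_add_left,
        intervalIntegral.integral_eq_sub_of_hasDerivAt (fun y _ => hf y)
          (hc'.intervalIntegrable _ _)]
      simp
    rw [h₂] at h₁
    refine h₁.trans (le_of_eq ?_)
    push_cast
    ring
  have h₃ := abs_integral_le_of_abs_le_pow 2 hδ.le hTaylor
  have h₄ : ∫ t in (0:ℝ)..δ, (f (x + t) - f x - t * f' x)
      = δ * (-steklovDiff δ f x - δ / 2 * f' x) := by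
    rw [intervalIntegral.integral_sub
      ((by fun_prop : Continuous fun t => f (x + t) - f x).intervalIntegrable _ _)
      ((by fun_prop : Continuous fun t => t * f' x).intervalIntegrable _ _),
      intervalIntegral.integral_mul_const, integral_id, steklovDiff, neg_sub,
      steklov_sub_self hδ hc]
    field_simp
    ring
  rw [h₄, abs_mul, abs_of_pos hδ] at h₃
  have h₅ : |-steklovDiff δ f x - δ / 2 * f' x| ≤ δ ^ 2 / 6 * Y := by
    refine le_of_mul_le_mul_left (h₃.trans (le_of_eq ?_)) hδ
    push_cast
    ring
  have h₆ := abs_sub_abs_le_abs_sub (δ / 2 * f' x) (-steklovDiff δ f x)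
  rw [abs_sub_comm, abs_neg, abs_mul, abs_of_pos (half_pos hδ)] at h₆
  linarith [hε x]

/-- A Bernstein-type estimate for the derivative of the twofold Steklov average. -/
lemma abs_deriv_steklov_steklov_le {ε : ℝ} (hδ : 0 < δ) (hf : Continuous f)
    (hM : ∀ x, |f x| ≤ M) (hε : ∀ x, |steklovDiff δ f x| ≤ ε) (x : ℝ) :
    |(steklov δ f (x + δ) - steklov δ f x) / δ| ≤ 10 * ε / δ := by
  have hTf : Continuous (steklov δ f) := steklov_continuous hf
  set w' : ℝ → ℝ := fun x => (steklov δ f (x + δ) - steklov δ f x) / δ with hw'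
  set v' : ℝ → ℝ := fun x => (f (x + δ) - f x) / δ with hv'
  have hbdd : BddAbove (Set.range fun x => |w' x|) := by
    refine ⟨2 * M / δ, ?_⟩
    rintro _ ⟨y, rfl⟩
    simp only [hw', abs_div, abs_of_pos hδ]
    gcongr
    have := abs_sub (steklov δ f (y + δ)) (steklov δ f y)
    linarith [abs_steklov_le hδ hM y, abs_steklov_le hδ hM (y + δ)]
  set X := ⨆ x, |w' x| with hX
  have hle : ∀ y, |w' y| ≤ X := le_ciSup hbdd
  have hv : ∀ y, |v' y| ≤ X + 2 * ε / δ := fun y => by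
    have h₁ : v' y = w' y + (steklovDiff δ f (y + δ) - steklovDiff δ f y) / δ := by
      simp only [hv', hw', steklovDiff]
      ring
    have h₂ : |(steklovDiff δ f (y + δ) - steklovDiff δ f y) / δ| ≤ 2 * ε / δ := by
      rw [abs_div, abs_of_pos hδ]
      gcongr
      linarith [abs_sub (steklovDiff δ f (y + δ)) (steklovDiff δ f y), hε y, hε (y + δ)]
    rw [h₁]
    exact (abs_add_le _ _).trans (add_le_add (hle y) h₂)
  have hd : ∀ y, HasDerivAt w' ((v' (y + δ) - v' y) / δ) y := fun y =>
    (((hasDerivAt_steklov hf (y + δ)).comp_add_const y δ).sub (hasDerivAt_steklov hf y)).div_const δ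
  have hY : ∀ y, |(v' (y + δ) - v' y) / δ| ≤ 2 * (X + 2 * ε / δ) / δ := fun y => by
    rw [abs_div, abs_of_pos hδ]
    gcongr
    linarith [abs_sub (v' (y + δ)) (v' y), hv y, hv (y + δ)]
  have hTT : ∀ y, |steklovDiff δ (steklov δ (steklov δ f)) y| ≤ ε := fun y => by
    have h₁ : steklovDiff δ (steklov δ (steklov δ f)) = steklov δ (steklov δ (steklovDiff δ f)) := by
      have h₂ : steklov δ (steklovDiff δ f) = fun x => steklov δ f x - steklov δ (steklov δ f) x :=
        steklov_sub hf hTf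
      rw [h₂, steklov_sub hTf (steklov_continuous hTf)]
      rfl
    rw [h₁]
    exact abs_steklov_le hδ (abs_steklov_le hδ hε) y
  have hbound : ∀ y, |w' y| ≤ 2 / 3 * X + 10 / 3 * (ε / δ) := fun y => by
    have h₁ := abs_deriv_le_of_steklovDiff hδ (hasDerivAt_steklov hTf) hd hTT hY y
    have h₂ : ε + δ ^ 2 / 6 * (2 * (X + 2 * ε / δ) / δ)
        = δ / 2 * (2 / 3 * X + 10 / 3 * (ε / δ)) := by
      field_simp
      ring
    rw [h₂] at h₁
    exact le_of_mul_le_mul_left h₁ (half_pos hδ)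
  have hXle : X ≤ 2 / 3 * X + 10 / 3 * (ε / δ) := ciSup_le hbound
  have := hle x
  rw [mul_div_assoc]
  linarith

lemma abs_steklovDiff_le_nine_mul {h ε : ℝ} (hh : 0 < h) (hhδ : h ≤ δ) (hf : Continuous f)
    (hM : ∀ x, |f x| ≤ M) (hε : ∀ x, |steklovDiff δ f x| ≤ ε) (x : ℝ) :
    |steklovDiff h f x| ≤ 9 * ε := by
  have hδ := hh.trans_le hhδ
  have hTf : Continuous (steklov δ f) := steklov_continuous hf
  have hε₀ : 0 ≤ ε := (abs_nonneg _).trans (hε x)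
  set w := steklov δ (steklov δ f) with hw
  have h₁ : ∀ y, |f y - w y| ≤ 2 * ε := fun y => by
    have h₂ : f y - w y = steklovDiff δ f y + steklov δ (steklovDiff δ f) y := by
      have h₃ := congrFun (steklov_sub (δ := δ) hf hTf) y
      change steklov δ (steklovDiff δ f) y = _ at h₃
      rw [h₃, steklovDiff]
      ring
    rw [h₂]
    linarith [abs_add_le (steklovDiff δ f y) (steklov δ (steklovDiff δ f) y), hε y,
      abs_steklov_le hδ hε y]
  have h₂ := abs_steklovDiff_le_of_hasDerivAt hh (hasDerivAt_steklov hTf)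
    (abs_deriv_steklov_steklov_le hδ hf hM hε) x
  have h₃ := abs_steklovDiff_le hh h₁ x
  have h₄ : steklovDiff h f x = steklovDiff h (fun y => f y - w y) x + steklovDiff h w x := by
    rw [steklovDiff, steklovDiff, steklovDiff, steklov_sub hf (steklov_continuous hTf)]
    ring
  have h₅ : h / 2 * (10 * ε / δ) ≤ 5 * ε := by
    have : h / δ ≤ 1 := (div_le_one hδ).2 hhδ
    calc h / 2 * (10 * ε / δ) = 5 * ε * (h / δ) := by ring
      _ ≤ 5 * ε := mul_le_of_le_one_right (by positivity) this
  rw [h₄]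
  linarith [abs_add_le (steklovDiff h (fun y => f y - w y) x) (steklovDiff h w x)]

lemma steklovDiff_iterate_continuous (hf : Continuous f) (n : ℕ) :
    Continuous ((steklovDiff δ)^[n] f) := by
  induction n with
  | zero => exact hf
  | succ n ih =>
    rw [Function.iterate_succ_apply']
    exact steklovDiff_continuous ih

lemma abs_steklovDiff_iterate_le (hδ : 0 < δ) (hM : ∀ x, |f x| ≤ M) (n : ℕ) (x : ℝ) :
    |(steklovDiff δ)^[n] f x| ≤ 2 ^ n * M := by
  induction n generalizing x with
  | zero => simpa using hM x
  | succ n ih =>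
    rw [Function.iterate_succ_apply', pow_succ', mul_assoc]
    exact abs_steklovDiff_le hδ ih x

lemma steklovDiff_iterate_comm (hf : Continuous f) (h δ : ℝ) (n : ℕ) :
    (steklovDiff δ)^[n] (steklovDiff h f) = steklovDiff h ((steklovDiff δ)^[n] f) := by
  induction n with
  | zero => rfl
  | succ n ih =>
    rw [Function.iterate_succ_apply', Function.iterate_succ_apply', ih,
      steklovDiff_comm (steklovDiff_iterate_continuous hf n)]

lemma abs_steklovDiff_iterate_le_nine_pow_mul {h ε : ℝ} (hh : 0 < h) (hhδ : h ≤ δ)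
    (hf : Continuous f) (hM : ∀ x, |f x| ≤ M) (n : ℕ)
    (hε : ∀ x, |(steklovDiff δ)^[n] f x| ≤ ε) (x : ℝ) :
    |(steklovDiff h)^[n] f x| ≤ 9 ^ n * ε := by
  induction n generalizing f M ε with
  | zero => simpa using hε x
  | succ n ih =>
    rw [Function.iterate_succ_apply, pow_succ, mul_assoc]
    refine ih (steklovDiff_continuous hf) (abs_steklovDiff_le hh hM) fun y => ?_
    rw [steklovDiff_iterate_comm hf]
    refine abs_steklovDiff_le_nine_mul hh hhδ (steklovDiff_iterate_continuous hf n)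
      (abs_steklovDiff_iterate_le (hh.trans_le hhδ) hM n) (fun z => ?_) y
    simpa only [Function.iterate_succ_apply'] using hε z

end SteklovAverage

theorem iter_diff_monotone_const (f : ℝ → ℝ) (hf : Continuous f)
    (hb : BddAbove (Set.range fun x => |f x|)) (r : ℕ) (hr : 1 ≤ r)
    (h δ : ℝ) (hh : 0 < h) (hhδ : h ≤ δ) :
    (1 + (r : ℝ) ^ r / 2 ^ r) * (⨆ x, |(steklovDiff h)^[r] f x|) ≤
      2 ^ (2 * r) * ((r : ℝ) ^ r + 34 ^ r) * 2 ^ r * ⨆ x, |(steklovDiff δ)^[r] f x| := by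
  obtain ⟨M, hM⟩ := hb
  replace hM : ∀ x, |f x| ≤ M := fun x => hM ⟨x, rfl⟩
  have hbdd : BddAbove (Set.range fun x => |(steklovDiff δ)^[r] f x|) := by
    refine ⟨2 ^ r * M, ?_⟩
    rintro _ ⟨y, rfl⟩
    exact abs_steklovDiff_iterate_le (hh.trans_le hhδ) hM r y
  have hsup : (⨆ x, |(steklovDiff h)^[r] f x|) ≤ 9 ^ r * ⨆ x, |(steklovDiff δ)^[r] f x| :=
    ciSup_le (abs_steklovDiff_iterate_le_nine_pow_mul hh hhδ hf hM r (le_ciSup hbdd))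
  have hnonneg : 0 ≤ ⨆ x, |(steklovDiff δ)^[r] f x| := Real.iSup_nonneg fun x => abs_nonneg _
  have hconst : (1 + (r : ℝ) ^ r / 2 ^ r) * 9 ^ r ≤
      2 ^ (2 * r) * ((r : ℝ) ^ r + 34 ^ r) * 2 ^ r := by
    have h₁ : (9 : ℝ) ^ r ≤ 8 ^ r * 34 ^ r := by
      rw [← mul_pow]
      gcongr
      norm_num
    have h₂ : (r : ℝ) ^ r / 2 ^ r * 9 ^ r ≤ 8 ^ r * (r : ℝ) ^ r := by
      rw [← div_pow, ← mul_pow, ← mul_pow]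
      refine pow_le_pow_left₀ (by positivity) ?_ r
      linarith [Nat.cast_nonneg (α := ℝ) r]
    have h₃ : (2 : ℝ) ^ (2 * r) * 2 ^ r = 8 ^ r := by
      rw [pow_mul, ← mul_pow]
      norm_num
    calc (1 + (r : ℝ) ^ r / 2 ^ r) * 9 ^ r = 9 ^ r + (r : ℝ) ^ r / 2 ^ r * 9 ^ r := by ring
      _ ≤ 8 ^ r * 34 ^ r + 8 ^ r * (r : ℝ) ^ r := add_le_add h₁ h₂
      _ = 2 ^ (2 * r) * ((r : ℝ) ^ r + 34 ^ r) * 2 ^ r := by rw [← h₃]; ring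
  calc (1 + (r : ℝ) ^ r / 2 ^ r) * (⨆ x, |(steklovDiff h)^[r] f x|)
      ≤ (1 + (r : ℝ) ^ r / 2 ^ r) * (9 ^ r * ⨆ x, |(steklovDiff δ)^[r] f x|) := by gcongr
    _ = (1 + (r : ℝ) ^ r / 2 ^ r) * 9 ^ r * ⨆ x, |(steklovDiff δ)^[r] f x| := by ring
    _ ≤ _ := by gcongr
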